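/- arXiv:math/0110187 — 3 statements merged into one kernel-verified Lean document; each statement's English description precedes it below -/
import Mathlib

section
/- Suppose there is a sequence (a_n) of vectors in ℝ^N with Euclidean norm ‖a_n‖_2 = 1 such that m(K_{a_n}) → 1 as n → ∞. Then there exists a ∈ ℝ^N with ‖a‖_2 = 1 such that a∘Φ(x) = 0 for every x ∈ [0,1]; in particular the functions x ↦ φ(x+k), k = 0, …, N−1, are linearly dependent on [0,1]. -/
open MeasureTheory

/-- The set `K_c = {x ∈ [0,1] : Σ_k c_k φ(x+k) = 0}`. -/
def Kset (N : ℕ) (φ : ℝ → ℝ) (c : Fin N → ℝ) : Set ℝ :=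
  {x ∈ Set.Icc (0 : ℝ) 1 | ∑ k : Fin N, c k * φ (x + (k.val : ℝ)) = 0}

theorem isCompact_setOf_sum_sq_eq_one (ι : Type*) [Fintype ι] :
    IsCompact {c : ι → ℝ | ∑ k, c k ^ 2 = 1} := by
  refine (isCompact_univ_pi fun _ : ι => isCompact_Icc (a := (-1 : ℝ)) (b := 1)).of_isClosed_subset
    (isClosed_eq (by fun_prop) continuous_const) fun c hc k _ => ?_
  have h : c k ^ 2 ≤ 1 := hc ▸
    Finset.single_le_sum (f := fun k => c k ^ 2) (fun i _ => sq_nonneg (c i)) (Finset.mem_univ k)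
  exact abs_le.mp ((sq_le_one_iff_abs_le_one _).mp h)

/-- If the zero sets in `[0,1]` of `F (c n)` have measure tending to `1` and `c n → b`, then
`F b` vanishes on `[0,1]`. -/
theorem eq_zero_on_Icc_of_tendsto_volume_zeros {E : Type*} [TopologicalSpace E] {F : E → ℝ → ℝ}
    (hF : Continuous (Function.uncurry F)) {c : ℕ → E} {b : E}
    (hc : Filter.Tendsto c Filter.atTop (nhds b))
    (hvol : Filter.Tendsto (fun n => volume {x ∈ Set.Icc (0 : ℝ) 1 | F (c n) x = 0})
      Filter.atTop (nhds 1)) :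
    ∀ x ∈ Set.Icc (0 : ℝ) 1, F b x = 0 := by
  have hFb : Continuous (F b) := hF.comp (Continuous.prodMk_right b)
  have hIoo : Set.Ioo (0 : ℝ) 1 ⊆ {x | F b x = 0} := by
    intro x hx
    by_contra hne
    have hev : ∀ᶠ p : E × ℝ in nhds b ×ˢ nhds x, Function.uncurry F p ≠ 0 := by
      rw [← nhds_prod_eq]
      exact hF.continuousAt.eventually_ne hne
    obtain ⟨p, hp, q, hq, hpq⟩ := Filter.eventually_prod_iff.mp hev
    obtain ⟨U, hU, hUo, hxU⟩ := mem_nhds_iff.mp (Filter.inter_mem hq (isOpen_Ioo.mem_nhds hx))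
    have hUpos : 0 < volume U := hUo.measure_pos volume ⟨x, hxU⟩
    have hUIcc : U ⊆ Set.Icc (0 : ℝ) 1 := fun y hy => Set.Ioo_subset_Icc_self (hU hy).2
    have hUfin : volume U ≠ ⊤ := measure_ne_top_of_subset hUIcc (by simp)
    have hle : ∀ᶠ n in Filter.atTop,
        volume {x ∈ Set.Icc (0 : ℝ) 1 | F (c n) x = 0} ≤ 1 - volume U := by
      filter_upwards [hc.eventually hp] with n hn
      calc volume {x ∈ Set.Icc (0 : ℝ) 1 | F (c n) x = 0}
          ≤ volume (Set.Icc (0 : ℝ) 1 \ U) :=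
            measure_mono fun y hy => ⟨hy.1, fun hyU => hpq hn (hU hyU).1 hy.2⟩
        _ = 1 - volume U := by
            rw [measure_sdiff hUIcc hUo.measurableSet.nullMeasurableSet hUfin]
            simp
    exact (ENNReal.sub_lt_self ENNReal.one_ne_top one_ne_zero hUpos.ne').not_ge
      (le_of_tendsto hvol hle)
  have hclosed : IsClosed {x | F b x = 0} := isClosed_eq hFb continuous_const
  rw [← closure_Ioo (zero_ne_one' ℝ)]
  exact fun x hx => hclosed.closure_subset_iff.mpr hIoo hx

/-- If there are unit vectors `a_n ∈ ℝ^N` with `m(K_{a_n}) → 1`, then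
there is a unit vector `a ∈ ℝ^N` with `a∘Φ ≡ 0` on `[0,1]`; in particular the
functions `x ↦ φ(x+k)`, `k = 0, …, N−1`, are linearly dependent on `[0,1]`. -/
theorem stmt_7
    (N : ℕ) (hN : 1 ≤ N) (φ : ℝ → ℝ) (hcont : Continuous φ)
    (hsupp : ∀ x : ℝ, x ∉ Set.Icc (0 : ℝ) (N : ℝ) → φ x = 0)
    (a : ℕ → Fin N → ℝ) (ha : ∀ n, ∑ k : Fin N, (a n k) ^ 2 = 1)
    (hvol : Filter.Tendsto (fun n => volume (Kset N φ (a n))) Filter.atTop (nhds 1)) :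
    (∃ b : Fin N → ℝ, (∑ k : Fin N, (b k) ^ 2 = 1) ∧
        ∀ x ∈ Set.Icc (0 : ℝ) 1, ∑ k : Fin N, b k * φ (x + (k.val : ℝ)) = 0) ∧
      ¬ LinearIndependent ℝ
          (fun k : Fin N => fun x : Set.Icc (0 : ℝ) 1 => φ ((x : ℝ) + (k.val : ℝ))) := by
  have hdep : ∃ b : Fin N → ℝ, (∑ k : Fin N, (b k) ^ 2 = 1) ∧
      ∀ x ∈ Set.Icc (0 : ℝ) 1, ∑ k : Fin N, b k * φ (x + (k.val : ℝ)) = 0 := by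
    obtain ⟨b, hb, s, hs, hlim⟩ := (isCompact_setOf_sum_sq_eq_one (Fin N)).tendsto_subseq ha
    have hF : Continuous (Function.uncurry fun (c : Fin N → ℝ) (x : ℝ) =>
        ∑ k : Fin N, c k * φ (x + (k.val : ℝ))) := by
      unfold Function.uncurry
      fun_prop
    exact ⟨b, hb, eq_zero_on_Icc_of_tendsto_volume_zeros hF hlim (hvol.comp hs.tendsto_atTop)⟩
  refine ⟨hdep, fun hli => ?_⟩
  obtain ⟨b, hb, hzero⟩ := hdep
  have hb0 : ∀ k, b k = 0 := Fintype.linearIndependent_iff.mp hli b <| by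
    ext x
    simpa using hzero x x.2
  simp [hb0] at hb
end

section
/- For a nonempty compact set A ⊆ [0,1], define C(A) := inf{ sup_{x∈A} |a∘Φ(x)| : a ∈ ℝ^N, ‖a‖_2 = 1 }. Then the map A ↦ C(A) is continuous on the space of nonempty compact subsets of [0,1] equipped with the Hausdorff metric. -/
open TopologicalSpace

theorem bddAbove_range_abs_restrict {X : Type*} [TopologicalSpace X] {g : X → ℝ}
    (hg : Continuous g) (A : NonemptyCompacts X) :
    BddAbove (Set.range fun x : (A : Set X) => |g x|) := by
  have h := A.isCompact.bddAbove_image (f := fun x => |g x|) hg.abs.continuousOn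
  rwa [Set.image_eq_range] at h

/-- If every function of a family varies by at most `ε` on pairs of points at distance less
than `δ`, then the minimax `⨅ i, ⨆ x ∈ A, |g i x|` increases by at most `ε` when `A` is moved
by less than `δ` in the Hausdorff metric. -/
theorem iInf_iSup_abs_le_add_of_dist_lt {X ι : Type*} [MetricSpace X] [Nonempty ι]
    {g : ι → X → ℝ} (hg : ∀ i, Continuous (g i)) {δ ε : ℝ}
    (h : ∀ i x y, dist x y < δ → |g i x - g i y| ≤ ε)
    {A B : NonemptyCompacts X} (hAB : dist A B < δ) :
    (⨅ i, ⨆ x : (A : Set X), |g i x|) ≤ (⨅ i, ⨆ x : (B : Set X), |g i x|) + ε := by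
  rw [← sub_le_iff_le_add]
  refine le_ciInf fun i => ?_
  rw [sub_le_iff_le_add]
  have hbdd : BddBelow (Set.range fun i => ⨆ x : (A : Set X), |g i x|) :=
    ⟨0, by rintro _ ⟨j, rfl⟩; exact Real.iSup_nonneg fun _ => abs_nonneg _⟩
  have : Nonempty (A : Set X) := A.nonempty.to_subtype
  refine (ciInf_le hbdd i).trans (ciSup_le fun x => ?_)
  obtain ⟨y, hy, hxy⟩ := Metric.exists_dist_lt_of_hausdorffDist_lt x.2
    (by rwa [Metric.NonemptyCompacts.dist_eq] at hAB)
    (Metric.hausdorffEDist_ne_top_of_nonempty_of_bounded A.nonempty B.nonempty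
      A.isCompact.isBounded B.isCompact.isBounded)
  have hB := le_ciSup (bddAbove_range_abs_restrict (hg i) B) ⟨y, hy⟩
  have hd := h i x y hxy
  have ht := abs_sub_abs_le_abs_sub (g i x) (g i y)
  dsimp only at hB
  linarith

/-- The map `A ↦ C(A) := inf{ sup_{x∈A} |a∘Φ(x)| : ‖a‖₂ = 1 }` is
continuous on the space of nonempty compact subsets of `[0,1]` with the Hausdorff
metric (formalized as `ContinuousOn` the set of nonempty compacts contained in
`[0,1]` inside the Hausdorff-metric space of nonempty compact subsets of `ℝ`). -/
theorem stmt_12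
    (N : ℕ) (hN : 1 ≤ N) (φ : ℝ → ℝ) (hcont : Continuous φ)
    (hsupp : ∀ x : ℝ, x ∉ Set.Icc (0 : ℝ) (N : ℝ) → φ x = 0) :
    ContinuousOn
      (fun A : NonemptyCompacts ℝ =>
        ⨅ a : {v : Fin N → ℝ // ∑ k : Fin N, (v k) ^ 2 = 1},
          ⨆ x : (A : Set ℝ), |∑ k : Fin N, (a : Fin N → ℝ) k * φ ((x : ℝ) + (k.val : ℝ))|)
      {A : NonemptyCompacts ℝ | (A : Set ℝ) ⊆ Set.Icc (0 : ℝ) 1} := by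
  have : Nonempty {v : Fin N → ℝ // ∑ k : Fin N, (v k) ^ 2 = 1} :=
    ⟨⟨Pi.single ⟨0, hN⟩ 1, by simp [Pi.single_apply]⟩⟩
  have hN' : (0 : ℝ) < N := by exact_mod_cast hN
  have huc : UniformContinuous φ :=
    (HasCompactSupport.intro isCompact_Icc hsupp).uniformContinuous_of_continuous hcont
  refine UniformContinuous.continuous (Metric.uniformContinuous_iff.2 fun ε hε => ?_)
    |>.continuousOn
  obtain ⟨δ, hδ, hφ⟩ := Metric.uniformContinuous_iff.1 huc (ε / 2 / N) (by positivity)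
  have key : ∀ (a : {v : Fin N → ℝ // ∑ k : Fin N, (v k) ^ 2 = 1}) (x y : ℝ), dist x y < δ →
      |∑ k : Fin N, a.1 k * φ (x + (k.val : ℝ)) - ∑ k : Fin N, a.1 k * φ (y + (k.val : ℝ))|
        ≤ ε / 2 := by
    intro a x y hxy
    have hterm : ∀ k : Fin N,
        |a.1 k * φ (x + (k.val : ℝ)) - a.1 k * φ (y + (k.val : ℝ))| ≤ ε / 2 / N := by
      intro k
      have ha : |a.1 k| ≤ 1 := by
        rw [← sq_le_one_iff_abs_le_one]
        exact (Finset.single_le_sum (f := fun k => a.1 k ^ 2) (fun _ _ => sq_nonneg _)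
          (Finset.mem_univ k)).trans_eq a.2
      have hd : dist (φ (x + (k.val : ℝ))) (φ (y + (k.val : ℝ))) < ε / 2 / N :=
        hφ (by rwa [dist_add_right])
      rw [Real.dist_eq] at hd
      rw [← mul_sub, abs_mul]
      exact (mul_le_of_le_one_left (abs_nonneg _) ha).trans hd.le
    rw [← Finset.sum_sub_distrib]
    refine (Finset.abs_sum_le_sum_abs _ _).trans ((Finset.sum_le_sum fun k _ => hterm k).trans ?_)
    rw [Finset.sum_const, Finset.card_univ, Fintype.card_fin, nsmul_eq_mul,
      mul_div_cancel₀ _ hN'.ne']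
  have hg : ∀ a : {v : Fin N → ℝ // ∑ k : Fin N, (v k) ^ 2 = 1},
      Continuous fun x : ℝ => ∑ k : Fin N, a.1 k * φ (x + (k.val : ℝ)) := fun a => by fun_prop
  refine ⟨δ, hδ, fun {A B} hAB => ?_⟩
  have h₁ := iInf_iSup_abs_le_add_of_dist_lt hg key hAB
  have h₂ := iInf_iSup_abs_le_add_of_dist_lt hg key (dist_comm A B ▸ hAB)
  rw [Real.dist_eq, abs_lt]
  constructor <;> linarith
end

section
/- For every δ > 0, the collection {A ⊆ [0,1] : A nonempty compact, m(A) ≥ δ} is a closed subset of the space of nonempty compact subsets of [0,1] equipped with the Hausdorff metric. -/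
open MeasureTheory TopologicalSpace

/-- An outer regular measure is upper semicontinuous on nonempty compact sets. -/
theorem upperSemicontinuous_measure_nonemptyCompacts {α : Type*} [TopologicalSpace α]
    [MeasurableSpace α] (μ : Measure α) [μ.OuterRegular] :
    UpperSemicontinuous fun K : NonemptyCompacts α => μ (K : Set α) := by
  intro K c hc
  obtain ⟨U, hKU, hU, hUc⟩ := (K : Set α).exists_isOpen_lt_of_lt c hc
  filter_upwards [(NonemptyCompacts.isOpen_subsets_of_isOpen hU).mem_nhds hKU] with L hL
  exact (measure_mono hL).trans_lt hUc

/-- For every `δ > 0`, the collection of nonempty compact subsets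
`A ⊆ [0,1]` with `m(A) ≥ δ` is closed in the space of nonempty compact subsets of
`[0,1]` equipped with the Hausdorff metric (formalized via the subspace
`{B : NonemptyCompacts ℝ // ↑B ⊆ [0,1]}`). -/
theorem stmt_13 (δ : ℝ) (hδ : 0 < δ) :
    IsClosed {A : {B : NonemptyCompacts ℝ // (B : Set ℝ) ⊆ Set.Icc (0 : ℝ) 1} |
      ENNReal.ofReal δ ≤ volume ((A : NonemptyCompacts ℝ) : Set ℝ)} := by
  exact ((upperSemicontinuous_measure_nonemptyCompacts volume).isClosed_preimage
    (ENNReal.ofReal δ)).preimage continuous_subtype_val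
end
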